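/- Every singular class belongs to exactly three *-sets. -/

import Mathlib

open Matrix

noncomputable section

/-- Gram matrix of the even lattice `2U(3) ⊕ A₂`. -/
def GramB : Matrix (Fin 6) (Fin 6) ℚ :=
  !![0,0,0,0,0,3; 0,0,0,0,3,0; 0,0,2,1,0,0; 0,0,1,2,0,0; 0,3,0,0,0,0; 3,0,0,0,0,0]

/-- The bilinear form on `V = ℚ⁶` with Gram matrix `GramB`. -/
def BB (x y : Fin 6 → ℚ) : ℚ := x ⬝ᵥ GramB.mulVec y

/-- The lattice `M = ℤ⁶ ⊆ ℚ⁶`. -/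
def MB : AddSubgroup (Fin 6 → ℚ) where
  carrier := {x | ∀ i, ∃ n : ℤ, x i = (n : ℚ)}
  zero_mem' := fun i => ⟨0, by simp⟩
  add_mem' := by
    intro a b ha hb i
    obtain ⟨n, hn⟩ := ha i
    obtain ⟨m, hm⟩ := hb i
    exact ⟨n + m, by simp [hn, hm]⟩
  neg_mem' := by
    intro a ha i
    obtain ⟨n, hn⟩ := ha i
    exact ⟨-n, by simp [hn]⟩

/-- The dual lattice `M^∨ = {x ∈ V : B(x,m) ∈ ℤ for all m ∈ M}`. -/
def MBdual : Set (Fin 6 → ℚ) := {x | ∀ m ∈ MB, ∃ n : ℤ, BB x m = (n : ℚ)}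

/-- The quotient `V/M` (containing the discriminant group `M^∨/M`). -/
abbrev QB := (Fin 6 → ℚ) ⧸ MB

/-- The projection `V → V/M`. -/
def pB : (Fin 6 → ℚ) → QB := QuotientAddGroup.mk

/-- A singular class: an unordered pair `{v+M, −v+M}` of cosets of order 3 in `M^∨/M`
with a representative `v` satisfying `B(v,v) = 2/3`. -/
def IsSingular (c : Sym2 QB) : Prop :=
  ∃ v : Fin 6 → ℚ, v ∈ MBdual ∧ addOrderOf (pB v) = 3 ∧ BB v v = 2/3 ∧
    c = s(pB v, pB (-v))

/-- The reflection `σ_v(x) = x − 3·B(v,x)·v` (for `B(v,v) = 2/3`). -/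
def reflB (v x : Fin 6 → ℚ) : Fin 6 → ℚ := x - (3 * BB v x) • v

/-- A `*`-set: five distinct singular classes such that `σ_v(v') ∈ (v'+M) ∪ (−v'+M)`
whenever `v, v' ∈ M^∨` have `B(v,v) = B(v',v') = 2/3` and represent cosets of
(possibly equal) classes of the set. -/
def IsStarSetB (S : Set (Sym2 QB)) : Prop :=
  S.ncard = 5 ∧ (∀ c ∈ S, IsSingular c) ∧
  ∀ v v' : Fin 6 → ℚ, v ∈ MBdual → v' ∈ MBdual →
    BB v v = 2/3 → BB v' v' = 2/3 →
    (∃ c ∈ S, pB v ∈ c) → (∃ c' ∈ S, pB v' ∈ c') →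
    (reflB v v' - v' ∈ MB ∨ reflB v v' + v' ∈ MB)

/-- Coordinates (shifted by 2, two bits each) of the 45 representatives. -/
def tabW : ℕ := 976577652504289029995985911033963074638981026585280584635754274953004207681230857674672477896871246965750720838259819570186710598740666

/-- Orthogonality relation (with diagonal) among the 45 representatives. -/
def tabA : ℕ := 1927452692449749114185217177138503946110924372426839946581702976973213981641116011701875816586612439807270057342432953894141499369687375241981320738355560735732285243848245532556124145980217034040493368405253314738997447765933451921666451847868040245068055664260436406137524295151613602427023441173827529926429131123480952665382617570541572130953968659327143707671103693944737809018373159253391197076204705844394273217017783742780399161699968932519830378312419969280573792275587713398015360009680805024335445920586173812007333816496022361259134754856521173985388080598129819878660999074501548993534487992995329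

/-- For each representative, one further point on each of its three lines (six bits each). -/
def tabP : ℕ := 751873589340085788804668456454122943346461205325261214694193924938067139525184890964969691842960098887917907181520332736403830139620927841843273346054572049255624712727977028437830980332062121498251707033789549520756786856589388271712838398601

def wN (i k : ℕ) : ℤ := ((tabW >>> (2 * (5 * i + k)) % 4 : ℕ) : ℤ) - 2

def adjN (i j : ℕ) : Bool := tabA.testBit (45 * i + j)

def ptN (i k : ℕ) : ℕ := tabP >>> (6 * (3 * i + k)) % 64

def nN (i j : ℕ) : ℤ :=
  wN i 0 * wN j 4 + wN i 4 * wN j 0 + wN i 1 * wN j 3 + wN i 3 * wN j 1 + 2 * (wN i 2 * wN j 2)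

def lineB (i : Fin 45) (k : Fin 3) : Finset (Fin 45) :=
  Finset.univ.filter (fun m => (adjN i m && adjN (ptN i k) m) = true)

theorem mem_lineB (i : Fin 45) (k : Fin 3) (m : Fin 45) :
    m ∈ lineB i k ↔ (adjN i m && adjN (ptN i k) m) = true := by
  simp [lineB]

theorem F1 : ∀ i k, (lineB i k).card = 5 := by decide +kernel

theorem F2 : ∀ (i : Fin 45) (k : Fin 3) (a : Fin 45), (adjN i a && adjN (ptN i k) a) = true →
    ∀ b : Fin 45, (adjN i b && adjN (ptN i k) b) = true → adjN a b = true := by decide +kernel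

theorem F3 : ∀ i j : Fin 45, adjN i j = true → i ≠ j → ∃ k : Fin 3, ∀ m : Fin 45,
    adjN i m = true → adjN j m = true → (adjN i m && adjN (ptN i k) m) = true := by decide +kernel

theorem F4 : ∀ (i : Fin 45) (k k' : Fin 3), k ≠ k' → ∃ m : Fin 45,
    (adjN i m && adjN (ptN i k) m) = true ∧
    ¬ (adjN i m && adjN (ptN i k') m) = true := by decide +kernel

theorem F4b : ∀ (i : Fin 45) (k : Fin 3), (adjN i i && adjN (ptN i k) i) = true := by
  decide +kernel

theorem F5 : ∀ i j : Fin 45, adjN i j = true → i = j ∨ nN i j % 3 = 0 := by decide +kernel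

theorem F6 : ∀ i j : Fin 45,
    (∀ k : Fin 5, (nN i j * wN i k) % 3 = 0) → adjN i j = true := by decide +kernel

theorem F6b : ∀ i j : Fin 45,
    (∀ k : Fin 5, (2 * wN j k - nN i j * wN i k) % 3 = 0) → adjN i j = true := by decide +kernel

set_option synthInstance.maxSize 4096 in
set_option synthInstance.maxHeartbeats 400000 in
theorem F7 : ∀ a b e c d : Fin 3, (a.val * d.val + b.val * c.val + e.val * e.val) % 3 = 1 →
    ∃ i : Fin 45,
      (((a.val : ℤ) - wN i 0) % 3 = 0 ∧ ((b.val : ℤ) - wN i 1) % 3 = 0 ∧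
       ((e.val : ℤ) - wN i 2) % 3 = 0 ∧ ((c.val : ℤ) - wN i 3) % 3 = 0 ∧
       ((d.val : ℤ) - wN i 4) % 3 = 0) ∨
      (((a.val : ℤ) + wN i 0) % 3 = 0 ∧ ((b.val : ℤ) + wN i 1) % 3 = 0 ∧
       ((e.val : ℤ) + wN i 2) % 3 = 0 ∧ ((c.val : ℤ) + wN i 3) % 3 = 0 ∧
       ((d.val : ℤ) + wN i 4) % 3 = 0) := by decide +kernel

theorem F8 : ∀ i j : Fin 45, (∀ k : Fin 5, (wN i k - wN j k) % 3 = 0) → i = j := by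
  decide +kernel

theorem F8b : ∀ i j : Fin 45, (∀ k : Fin 5, (wN i k + wN j k) % 3 = 0) → i = j := by
  decide +kernel

theorem F9 : ∀ i : Fin 45, nN i i = 2 := by decide +kernel

theorem F10 : ∀ i : Fin 45, ∃ k : Fin 5, wN i k % 3 ≠ 0 := by decide +kernel

theorem div3 (x : ℤ) : x % 3 = 0 ↔ ∃ n : ℤ, (x : ℚ) / 3 = n := by
  constructor
  · intro h
    obtain ⟨n, rfl⟩ := Int.dvd_of_emod_eq_zero h
    exact ⟨n, by push_cast; ring⟩
  · rintro ⟨n, hn⟩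
    have h2 : (x : ℚ) = ((3 * n : ℤ) : ℚ) := by push_cast; linarith
    have h3 : x = 3 * n := by exact_mod_cast h2
    omega

theorem BB_formula (x y : Fin 6 → ℚ) : BB x y =
    3 * (x 0 * y 5 + x 5 * y 0 + x 1 * y 4 + x 4 * y 1)
      + 2 * (x 2 * y 2) + x 2 * y 3 + x 3 * y 2 + 2 * (x 3 * y 3) := by
  simp [BB, GramB, dotProduct, Matrix.mulVec, Fin.sum_univ_six]
  ring

theorem mem_MB_iff (x : Fin 6 → ℚ) : x ∈ MB ↔ ∀ i, ∃ n : ℤ, x i = (n : ℚ) := Iff.rfl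

/-- A vector of the dual lattice with integer coordinates `a b e c d`. -/
def vecB (a b e c d : ℤ) : Fin 6 → ℚ :=
  ![(a : ℚ) / 3, (b : ℚ) / 3, (e : ℚ) / 3, (e : ℚ) / 3, (c : ℚ) / 3, (d : ℚ) / 3]

theorem vecB_mem (a b e c d : ℤ) : vecB a b e c d ∈ MB ↔
    a % 3 = 0 ∧ b % 3 = 0 ∧ e % 3 = 0 ∧ c % 3 = 0 ∧ d % 3 = 0 := by
  rw [mem_MB_iff, Fin.forall_fin_succ, Fin.forall_fin_succ, Fin.forall_fin_succ,
    Fin.forall_fin_succ, Fin.forall_fin_succ, Fin.forall_fin_one]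
  simp only [div3]
  simp [vecB]

def WB (i : Fin 45) : Fin 6 → ℚ := vecB (wN i 0) (wN i 1) (wN i 2) (wN i 3) (wN i 4)

theorem vecB_sub (a b e c d a' b' e' c' d' : ℤ) :
    vecB a b e c d - vecB a' b' e' c' d' = vecB (a - a') (b - b') (e - e') (c - c') (d - d') := by
  ext k; fin_cases k <;> simp [vecB] <;> ring

theorem vecB_add (a b e c d a' b' e' c' d' : ℤ) :
    vecB a b e c d + vecB a' b' e' c' d' = vecB (a + a') (b + b') (e + e') (c + c') (d + d') := by
  ext k; fin_cases k <;> simp [vecB] <;> ring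

theorem vecB_smul (n a b e c d : ℤ) :
    (n : ℚ) • vecB a b e c d = vecB (n * a) (n * b) (n * e) (n * c) (n * d) := by
  ext k; fin_cases k <;> simp [vecB] <;> ring

theorem forall5 {p : ℕ → Prop} (h0 : p 0) (h1 : p 1) (h2 : p 2) (h3 : p 3) (h4 : p 4) :
    ∀ k : Fin 5, p k := by
  intro k; fin_cases k <;> assumption

theorem BB_WB (i j : Fin 45) : 3 * BB (WB i) (WB j) = (nN i j : ℚ) := by
  rw [BB_formula]
  simp [WB, vecB, nN]
  ring

theorem BB_WB_self (i : Fin 45) : BB (WB i) (WB i) = 2 / 3 := by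
  have h := BB_WB i i
  rw [F9] at h
  push_cast at h
  linarith

theorem BB_comm (x y : Fin 6 → ℚ) : BB x y = BB y x := by
  rw [BB_formula, BB_formula]; ring

theorem BB_add_left (x y z : Fin 6 → ℚ) : BB (x + y) z = BB x z + BB y z := by
  simp only [BB_formula, Pi.add_apply]; ring

theorem BB_add_right (x y z : Fin 6 → ℚ) : BB z (x + y) = BB z x + BB z y := by
  simp only [BB_formula, Pi.add_apply]; ring

theorem BB_neg_left (x z : Fin 6 → ℚ) : BB (-x) z = - BB x z := by
  simp only [BB_formula, Pi.neg_apply]; ring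

theorem BB_neg_right (x z : Fin 6 → ℚ) : BB z (-x) = - BB z x := by
  simp only [BB_formula, Pi.neg_apply]; ring

theorem WB_dual (i : Fin 45) : WB i ∈ MBdual := by
  intro m hm
  obtain ⟨m0, h0⟩ := hm 0
  obtain ⟨m1, h1⟩ := hm 1
  obtain ⟨m2, h2⟩ := hm 2
  obtain ⟨m3, h3⟩ := hm 3
  obtain ⟨m4, h4⟩ := hm 4
  obtain ⟨m5, h5⟩ := hm 5
  refine ⟨wN i 0 * m5 + wN i 4 * m0 + wN i 1 * m4 + wN i 3 * m1 + wN i 2 * m2 + wN i 2 * m3, ?_⟩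
  rw [BB_formula, h0, h1, h2, h3, h4, h5]
  simp [WB, vecB]
  ring

theorem MB_dual (m m' : Fin 6 → ℚ) (hm : m ∈ MB) (hm' : m' ∈ MB) : ∃ n : ℤ, BB m m' = n := by
  choose f hf using hm
  choose g hg using hm'
  refine ⟨3 * (f 0 * g 5 + f 5 * g 0 + f 1 * g 4 + f 4 * g 1)
      + 2 * (f 2 * g 2) + f 2 * g 3 + f 3 * g 2 + 2 * (f 3 * g 3), ?_⟩
  rw [BB_formula]
  simp only [hf, hg]
  push_cast
  ring

theorem smul_mem_MB (n : ℤ) (x : Fin 6 → ℚ) (hx : x ∈ MB) : (n : ℚ) • x ∈ MB := by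
  intro k
  obtain ⟨t, ht⟩ := hx k
  exact ⟨n * t, by simp [ht]⟩

theorem three_WB (i : Fin 45) : ((3 : ℤ) : ℚ) • WB i ∈ MB := by
  rw [WB, vecB_smul, vecB_mem]
  omega

theorem WB_not_mem (i : Fin 45) : WB i ∉ MB := by
  rw [WB, vecB_mem]
  rintro ⟨h0, h1, h2, h3, h4⟩
  obtain ⟨k, hk⟩ := F10 i
  exact hk (forall5 (p := fun k => wN i k % 3 = 0) h0 h1 h2 h3 h4 k)

/-- Every vector of norm `2/3` in the dual is congruent to plus or minus a representative. -/
theorem exists_WB (v : Fin 6 → ℚ) (hv : v ∈ MBdual) (hn : BB v v = 2 / 3) :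
    ∃ i, v - WB i ∈ MB ∨ v + WB i ∈ MB := by
  have key : ∀ k : Fin 6, ∃ n : ℤ, BB v (Pi.single k 1) = n := by
    intro k
    apply hv
    intro l
    by_cases h : l = k
    · subst h; exact ⟨1, by simp⟩
    · exact ⟨0, by simp [h]⟩
  obtain ⟨d, hd⟩ := key 0
  obtain ⟨c, hc⟩ := key 1
  obtain ⟨p, hp⟩ := key 2
  obtain ⟨q, hq⟩ := key 3
  obtain ⟨b, hb⟩ := key 4
  obtain ⟨a, ha⟩ := key 5
  rw [BB_formula] at ha hb hc hd hp hq hn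
  simp at ha hb hc hd hp hq
  have e0 : v 0 = a / 3 := by linarith
  have e1 : v 1 = b / 3 := by linarith
  have e4 : v 4 = c / 3 := by linarith
  have e5 : v 5 = d / 3 := by linarith
  have e2 : v 2 = (2 * p - q) / 3 := by linarith
  have e3 : v 3 = (2 * p - q) / 3 + (q - p) := by linarith
  rw [e0, e1, e2, e3, e4, e5] at hn
  obtain ⟨e, he⟩ : ∃ e : ℤ, e = 2 * p - q := ⟨_, rfl⟩
  obtain ⟨t, ht⟩ : ∃ t : ℤ, t = q - p := ⟨_, rfl⟩
  have he' : (2 * p - q : ℚ) = e := by rw [he]; push_cast; ring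
  have ht' : (q - p : ℚ) = t := by rw [ht]; push_cast; ring
  rw [he', ht'] at e3 hn
  rw [he'] at e2
  have hint : a * d + b * c + e * e + 3 * (e * t + t * t) = 1 := by
    have : ((a * d + b * c + e * e + 3 * (e * t + t * t) : ℤ) : ℚ) = (1 : ℤ) := by
      push_cast; linarith
    exact_mod_cast this
  have hv' : v = vecB a b e c d + Pi.single 3 (t : ℚ) := by
    ext k; fin_cases k <;> simp [vecB, e0, e1, e2, e3, e4, e5]
  have ht3 : (Pi.single 3 (t : ℚ) : Fin 6 → ℚ) ∈ MB := by
    intro l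
    by_cases h : l = 3
    · subst h; exact ⟨t, by simp⟩
    · exact ⟨0, by simp [h]⟩
  have red : ∀ x : ℤ, ∃ f : Fin 3, ∃ y : ℤ, x = f.val + 3 * y := by
    intro x
    refine ⟨⟨(x % 3).toNat, by omega⟩, x / 3, ?_⟩
    simp only
    omega
  obtain ⟨a', ya, hya⟩ := red a
  obtain ⟨b', yb, hyb⟩ := red b
  obtain ⟨e', ye, hye⟩ := red e
  obtain ⟨c', yc, hyc⟩ := red c
  obtain ⟨d', yd, hyd⟩ := red d
  have hmod : (a'.val * d'.val + b'.val * c'.val + e'.val * e'.val) % 3 = 1 := by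
    have h1 : ((a'.val * d'.val + b'.val * c'.val + e'.val * e'.val : ℕ) : ℤ) =
      1 + 3 * (-(a'.val * yd + ya * d'.val + 3 * ya * yd + b'.val * yc + yb * c'.val + 3 * yb * yc
        + 2 * e'.val * ye + 3 * ye * ye + e * t + t * t)) := by
      have h2 := hint
      rw [hya, hyb, hyc, hyd] at h2
      have h3 : e * e = e'.val * e'.val + 3 * (2 * e'.val * ye + 3 * ye * ye) := by
        rw [hye]; ring
      rw [h3] at h2
      push_cast
      linarith
    omega
  obtain ⟨i, hi⟩ := F7 a' b' e' c' d' hmod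
  refine ⟨i, ?_⟩
  rcases hi with ⟨h0, h1, h2, h3, h4⟩ | ⟨h0, h1, h2, h3, h4⟩
  · left
    have : v - WB i = (vecB a b e c d - WB i) + Pi.single 3 (t : ℚ) := by rw [hv']; abel
    rw [this]
    refine MB.add_mem ?_ ht3
    rw [WB, vecB_sub, vecB_mem]
    omega
  · right
    have : v + WB i = (vecB a b e c d + WB i) + Pi.single 3 (t : ℚ) := by rw [hv']; abel
    rw [this]
    refine MB.add_mem ?_ ht3
    rw [WB, vecB_add, vecB_mem]
    omega

def okB (v v' : Fin 6 → ℚ) : Prop := reflB v v' - v' ∈ MB ∨ reflB v v' + v' ∈ MB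

theorem okB_neg_left (v v' : Fin 6 → ℚ) (h : okB v v') : okB (-v) v' := by
  have : reflB (-v) v' = reflB v v' := by
    simp [reflB, BB_neg_left]
  rwa [okB, this]

theorem okB_neg_right (v v' : Fin 6 → ℚ) (h : okB v v') : okB v (-v') := by
  have : reflB v (-v') = - reflB v v' := by
    simp only [reflB, BB_neg_right]
    ext k; simp; ring
  rw [okB, this]
  rcases h with h | h
  · left
    have h2 := MB.neg_mem h
    convert h2 using 1; abel
  · right
    have h2 := MB.neg_mem h
    convert h2 using 1; abel

theorem okB_of_adj (i j : Fin 45) (h : adjN i j = true) (m m' : Fin 6 → ℚ)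
    (hm : m ∈ MB) (hm' : m' ∈ MB) : okB (WB i + m) (WB j + m') := by
  have hB : ∃ z : ℤ, 3 * BB (WB i + m) (WB j + m') = ((nN i j + 3 * z : ℤ) : ℚ) := by
    obtain ⟨x, hx⟩ := WB_dual i m' hm'
    obtain ⟨y, hy⟩ := WB_dual j m hm
    obtain ⟨z, hz⟩ := MB_dual m m' hm hm'
    refine ⟨x + y + z, ?_⟩
    rw [BB_add_left, BB_add_right, BB_add_right, hx, BB_comm m (WB j), hy, hz]
    have := BB_WB i j
    push_cast
    linarith
  obtain ⟨z, hz⟩ := hB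
  have h3 : ((3 : ℤ) : ℚ) • (WB i + m) ∈ MB := by
    rw [smul_add]
    exact MB.add_mem (three_WB i) (smul_mem_MB 3 m hm)
  rcases F5 i j h with rfl | h0
  · right
    rw [F9] at hz
    have : reflB (WB i + m) (WB i + m') + (WB i + m') =
        ((2 : ℤ) : ℚ) • m' - ((2 : ℤ) : ℚ) • m - (z : ℚ) • (((3 : ℤ) : ℚ) • (WB i + m)) := by
      rw [reflB, hz]
      ext k; simp; ring
    rw [this]
    exact MB.sub_mem (MB.sub_mem (smul_mem_MB 2 _ hm') (smul_mem_MB 2 _ hm)) (smul_mem_MB z _ h3)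
  · left
    obtain ⟨y, hy⟩ := Int.dvd_of_emod_eq_zero h0
    have : reflB (WB i + m) (WB j + m') - (WB j + m') =
        ((-(y + z) : ℤ) : ℚ) • (((3 : ℤ) : ℚ) • (WB i + m)) := by
      rw [reflB, hz, hy]
      ext k; simp; ring
    rw [this]
    exact smul_mem_MB _ _ h3

theorem adj_of_okB (i j : Fin 45) (h : okB (WB i) (WB j)) : adjN i j = true := by
  rw [okB, reflB, BB_WB] at h
  rcases h with h | h
  · have h1 := MB.neg_mem h
    have h2 : -(WB j - (nN i j : ℚ) • WB i - WB j) = (nN i j : ℚ) • WB i := by abel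
    rw [h2, WB, vecB_smul, vecB_mem] at h1
    obtain ⟨h0, h1, h2, h3, h4⟩ := h1
    exact F6 i j (forall5 (p := fun k => (nN i j * wN i k) % 3 = 0) h0 h1 h2 h3 h4)
  · have h2 : WB j - (nN i j : ℚ) • WB i + WB j = WB j + WB j - (nN i j : ℚ) • WB i := by abel
    rw [h2, WB, WB, vecB_smul, vecB_add, vecB_sub, vecB_mem] at h
    simp only [← two_mul] at h
    obtain ⟨h0, h1, h2, h3, h4⟩ := h
    exact F6b i j
      (forall5 (p := fun k => (2 * wN j k - nN i j * wN i k) % 3 = 0) h0 h1 h2 h3 h4)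

def clsB (i : Fin 45) : Sym2 QB := s(pB (WB i), pB (-(WB i)))

theorem pB_eq (x y : Fin 6 → ℚ) : pB x = pB y ↔ x - y ∈ MB := by
  unfold pB
  rw [QuotientAddGroup.eq, ← MB.neg_mem_iff]
  have : -(-x + y) = x - y := by abel
  rw [this]

theorem mem_clsB (v : Fin 6 → ℚ) (i : Fin 45) :
    pB v ∈ clsB i ↔ v - WB i ∈ MB ∨ v + WB i ∈ MB := by
  rw [clsB, Sym2.mem_iff, pB_eq, pB_eq, sub_neg_eq_add]

theorem clsB_inj : Function.Injective clsB := by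
  intro i j h
  have h1 : pB (WB i) ∈ clsB j := by
    rw [← h, clsB]; exact Sym2.mem_mk_left _ _
  rw [mem_clsB, WB, WB, vecB_sub, vecB_add, vecB_mem, vecB_mem] at h1
  rcases h1 with ⟨h0, h1, h2, h3, h4⟩ | ⟨h0, h1, h2, h3, h4⟩
  · exact F8 i j (forall5 (p := fun k => (wN i k - wN j k) % 3 = 0) h0 h1 h2 h3 h4)
  · exact F8b i j (forall5 (p := fun k => (wN i k + wN j k) % 3 = 0) h0 h1 h2 h3 h4)

theorem singular_clsB (i : Fin 45) : IsSingular (clsB i) := by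
  refine ⟨WB i, WB_dual i, ?_, BB_WB_self i, rfl⟩
  have : Fact (Nat.Prime 3) := ⟨by norm_num⟩
  apply addOrderOf_eq_prime
  · have h : pB ((3 : ℕ) • WB i) = 0 := by
      have h0 : pB ((3 : ℕ) • WB i) = pB 0 := by
        rw [pB_eq, sub_zero]
        have := three_WB i
        convert this using 1
        ext k; simp
      exact h0
    exact h
  · intro h
    have h0 : pB (WB i) = pB 0 := h
    rw [pB_eq, sub_zero] at h0
    exact WB_not_mem i h0

theorem exists_clsB (c : Sym2 QB) (hc : IsSingular c) : ∃ i, clsB i = c := by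
  obtain ⟨v, hv, -, hn, rfl⟩ := hc
  obtain ⟨i, h | h⟩ := exists_WB v hv hn
  · refine ⟨i, ?_⟩
    have h1 : pB v = pB (WB i) := (pB_eq _ _).2 h
    have h2 : pB (-v) = pB (-(WB i)) := by
      rw [pB_eq]
      have := MB.neg_mem h
      convert this using 1; abel
    rw [clsB, h1, h2]
  · refine ⟨i, ?_⟩
    have h1 : pB v = pB (-(WB i)) := (pB_eq _ _).2 (by simpa using h)
    have h2 : pB (-v) = pB (WB i) := by
      rw [pB_eq]
      have := MB.neg_mem h
      convert this using 1; abel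
    rw [clsB, h1, h2, Sym2.eq_swap]

theorem star_iff (T : Finset (Fin 45)) : IsStarSetB (Set.image clsB (T : Set (Fin 45))) ↔
    T.card = 5 ∧ ∀ i ∈ T, ∀ j ∈ T, adjN i j = true := by
  have hcard : (Set.image clsB (T : Set (Fin 45))).ncard = T.card := by
    rw [Set.ncard_image_of_injective _ clsB_inj, Set.ncard_coe_finset]
  constructor
  · rintro ⟨h5, -, h⟩
    refine ⟨hcard ▸ h5, fun i hi j hj => adj_of_okB i j ?_⟩
    exact h (WB i) (WB j) (WB_dual i) (WB_dual j) (BB_WB_self i) (BB_WB_self j)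
      ⟨clsB i, ⟨i, hi, rfl⟩, Sym2.mem_mk_left _ _⟩ ⟨clsB j, ⟨j, hj, rfl⟩, Sym2.mem_mk_left _ _⟩
  · rintro ⟨h5, h⟩
    refine ⟨hcard.trans h5, ?_, ?_⟩
    · rintro _ ⟨i, -, rfl⟩
      exact singular_clsB i
    · rintro v v' - - - - ⟨_, ⟨i, hi, rfl⟩, hv⟩ ⟨_, ⟨j, hj, rfl⟩, hv'⟩
      rw [mem_clsB] at hv hv'
      have hadj := h i hi j hj
      change okB v v'
      have rep : ∀ (x : Fin 6 → ℚ) (l : Fin 45), (x - WB l ∈ MB ∨ x + WB l ∈ MB) →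
          ∃ m ∈ MB, x = WB l + m ∨ x = -(WB l + m) := by
        rintro x l (hx | hx)
        · exact ⟨_, hx, Or.inl (by abel)⟩
        · exact ⟨_, MB.neg_mem hx, Or.inr (by abel)⟩
      obtain ⟨m, hm, e⟩ := rep v i hv
      obtain ⟨m', hm', e'⟩ := rep v' j hv'
      have hok := okB_of_adj i j hadj m m' hm hm'
      rcases e with rfl | rfl <;> rcases e' with rfl | rfl
      · exact hok
      · exact okB_neg_right _ _ hok
      · exact okB_neg_left _ _ hok
      · exact okB_neg_left _ _ (okB_neg_right _ _ hok)

theorem lineB_inj (i : Fin 45) : Function.Injective (lineB i) := by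
  intro k k' h
  by_contra hne
  obtain ⟨m, h1, h2⟩ := F4 i k k' hne
  rw [← mem_lineB] at h1 h2
  exact h2 (h ▸ h1)

/-- The cliques of size five through `i` are exactly the three lines. -/
theorem clique_iff (i : Fin 45) (T : Finset (Fin 45)) :
    ((T.card = 5 ∧ ∀ a ∈ T, ∀ b ∈ T, adjN a b = true) ∧ i ∈ T) ↔ ∃ k, lineB i k = T := by
  constructor
  · rintro ⟨⟨h5, h⟩, hi⟩
    obtain ⟨j, hj, hne⟩ := Finset.exists_mem_ne (by omega : 1 < T.card) i
    obtain ⟨k, hk⟩ := F3 i j (h i hi j hj) hne.symm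
    refine ⟨k, (Finset.eq_of_subset_of_card_le ?_ ?_).symm⟩
    · intro m hm
      rw [mem_lineB]
      exact hk m (h i hi m hm) (h j hj m hm)
    · rw [F1, h5]
  · rintro ⟨k, rfl⟩
    refine ⟨⟨F1 i k, fun a ha b hb => ?_⟩, ?_⟩
    · rw [mem_lineB] at ha hb
      exact F2 i k a ha b hb
    · rw [mem_lineB]
      exact F4b i k

/-- Every singular class belongs to exactly three `*`-sets. -/
theorem statement11 (c : Sym2 QB) (hc : IsSingular c) :
    {S : Set (Sym2 QB) | IsStarSetB S ∧ c ∈ S}.ncard = 3 := by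
  obtain ⟨i, rfl⟩ := exists_clsB c hc
  have hset : {S : Set (Sym2 QB) | IsStarSetB S ∧ clsB i ∈ S} =
      Set.range (fun k : Fin 3 => Set.image clsB (lineB i k : Set (Fin 45))) := by
    ext S
    constructor
    · rintro ⟨hS, hi⟩
      obtain ⟨T, rfl⟩ : ∃ T : Finset (Fin 45), S = Set.image clsB (T : Set (Fin 45)) := by
        refine ⟨(Set.toFinite (clsB ⁻¹' S)).toFinset, ?_⟩
        rw [Set.Finite.coe_toFinset, Set.image_preimage_eq_of_subset]
        intro c hcS
        exact exists_clsB c (hS.2.1 c hcS)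
      have hiT : i ∈ T := by
        obtain ⟨j, hj, hji⟩ := hi
        rw [← clsB_inj hji]
        exact hj
      obtain ⟨k, rfl⟩ := (clique_iff i T).1 ⟨(star_iff T).1 hS, hiT⟩
      exact ⟨k, rfl⟩
    · rintro ⟨k, rfl⟩
      obtain ⟨h, hi⟩ := (clique_iff i (lineB i k)).2 ⟨k, rfl⟩
      exact ⟨(star_iff _).2 h, ⟨i, hi, rfl⟩⟩
  rw [hset, ← Set.image_univ, Set.ncard_image_of_injective, Set.ncard_univ, Nat.card_fin]
  intro k k' h
  exact lineB_inj i (Finset.coe_injective (clsB_inj.image_injective h))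

end
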